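/- Let X : ℕ → ℤ be a sequence such that every integer is visited infinitely often (so all the stopping times τ_{k,m} are finite), and let σ > 0 be defined by σ² = (Σ_{x∈ℤ} x² λ^{x²})/(Σ_{x∈ℤ} λ^{x²}) for a fixed λ ∈ (0,1). For x, h ∈ ℝ with h ≥ 0 and n ≥ 1, define the rescaled local time curve Λⁿ_{x,h}(y) = L(τ_{⌊xn⌋, ⌊2σh√n⌋}, ⌊yn⌋)/(2σ√n). Then for any reals x ≠ y, any h, h' ≥ 0, and any n ≥ 1 with ⌊xn⌋ ≠ ⌊yn⌋, one has Λⁿ_{x,h}(y) ≤ h' if and only if Λⁿ_{x,h}(x) ≤ Λⁿ_{y,h'}(x). -/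

import Mathlib

noncomputable section

/-- The local time of the sequence `X` at site `k` up to time `n` (inclusively). -/
def locTime (X : ℕ → ℤ) (n : ℕ) (k : ℤ) : ℕ :=
  ((Finset.range (n + 1)).filter fun i => X i = k).card

/-- The inverse local time `τ_{k,m}`: the time of the `(m+1)`-th visit of `X` to `k`. -/
def invLocTime (X : ℕ → ℤ) (k : ℤ) (m : ℕ) : ℕ :=
  sInf {n | m < locTime X n k}

/-- The rescaled local-time curve `Λⁿ_{x,h}(y)`. -/
def rescaledCurve (X : ℕ → ℤ) (σ : ℝ) (n : ℕ) (x h y : ℝ) : ℝ :=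
  (locTime X (invLocTime X ⌊x * (n : ℝ)⌋ ⌊2 * σ * h * Real.sqrt n⌋₊) ⌊y * (n : ℝ)⌋ : ℝ) /
    (2 * σ * Real.sqrt n)

theorem locTime_zero (X : ℕ → ℤ) (k : ℤ) : locTime X 0 k = if X 0 = k then 1 else 0 := by
  simp only [locTime, zero_add, Finset.range_one, Finset.filter_singleton]
  split_ifs <;> simp

theorem locTime_succ (X : ℕ → ℤ) (n : ℕ) (k : ℤ) :
    locTime X (n + 1) k = locTime X n k + if X (n + 1) = k then 1 else 0 := by
  simp only [locTime, Finset.range_add_one (n := n + 1), Finset.filter_insert]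
  split_ifs <;> simp

theorem locTime_mono (X : ℕ → ℤ) (k : ℤ) : Monotone fun n => locTime X n k :=
  monotone_nat_of_le_succ fun n => by simp [locTime_succ]

theorem exists_lt_locTime {X : ℕ → ℤ} {k : ℤ} (hX : ∀ N, ∃ n ≥ N, X n = k) (m : ℕ) :
    ∃ n, m < locTime X n k := by
  induction m with
  | zero =>
    obtain ⟨n, -, hn⟩ := hX 0
    exact ⟨n, Finset.card_pos.2 ⟨n, by simp [hn]⟩⟩
  | succ m ih =>
    obtain ⟨N, hN⟩ := ih
    obtain ⟨n, hnN, hn⟩ := hX (N + 1)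
    obtain ⟨n, rfl⟩ := Nat.exists_eq_add_of_le' (show 1 ≤ n by omega)
    have : locTime X N k ≤ locTime X n k := locTime_mono X k (by omega)
    exact ⟨n + 1, by rw [locTime_succ, if_pos hn]; omega⟩

theorem invLocTime_le_iff {X : ℕ → ℤ} {k : ℤ} (hX : ∀ N, ∃ n ≥ N, X n = k) {m n : ℕ} :
    invLocTime X k m ≤ n ↔ m < locTime X n k :=
  ⟨fun h => lt_of_lt_of_le
      (show invLocTime X k m ∈ {n | m < locTime X n k} from Nat.sInf_mem (exists_lt_locTime hX m))
      (locTime_mono X k h),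
    fun h => Nat.sInf_le h⟩

theorem apply_invLocTime_and_locTime_invLocTime {X : ℕ → ℤ} {k : ℤ}
    (hX : ∀ N, ∃ n ≥ N, X n = k) (m : ℕ) :
    X (invLocTime X k m) = k ∧ locTime X (invLocTime X k m) k = m + 1 := by
  have hlt := (invLocTime_le_iff hX (m := m)).1 le_rfl
  have hbefore : ∀ n < invLocTime X k m, locTime X n k ≤ m := fun n hn =>
    not_lt.1 fun h => hn.not_ge ((invLocTime_le_iff hX).2 h)
  rcases hτ : invLocTime X k m with _ | n
  · rw [hτ, locTime_zero] at hlt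
    rw [locTime_zero]
    split_ifs at hlt ⊢ with h
    · exact ⟨h, by omega⟩
    · omega
  · have hn := hbefore n (by omega)
    rw [hτ, locTime_succ] at hlt
    rw [locTime_succ]
    split_ifs at hlt ⊢ with h
    · exact ⟨h, by omega⟩
    · omega

theorem locTime_invLocTime_duality {X : ℕ → ℤ} {a b : ℤ} (ha : ∀ N, ∃ n ≥ N, X n = a)
    (hb : ∀ N, ∃ n ≥ N, X n = b) (hab : a ≠ b) (m m' : ℕ) :
    locTime X (invLocTime X a m) b ≤ m' ↔
      locTime X (invLocTime X a m) a ≤ locTime X (invLocTime X b m') a := by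
  obtain ⟨hXa, hLa⟩ := apply_invLocTime_and_locTime_invLocTime ha m
  have hXb := (apply_invLocTime_and_locTime_invLocTime hb m').1
  have hne : invLocTime X a m ≠ invLocTime X b m' := fun h => hab (by rw [← hXa, h, hXb])
  rw [hLa, Nat.add_one_le_iff, ← invLocTime_le_iff ha, ← not_lt, ← invLocTime_le_iff hb]
  omega

/-- Duality for the rescaled discrete local-time curves:
`Λⁿ_{x,h}(y) ≤ h'` if and only if `Λⁿ_{x,h}(x) ≤ Λⁿ_{y,h'}(x)`. -/
theorem rescaledCurve_duality (lam : ℝ) (hlam : lam ∈ Set.Ioo (0 : ℝ) 1)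
    (X : ℕ → ℤ) (hX : ∀ k : ℤ, ∀ N : ℕ, ∃ n ≥ N, X n = k)
    (σ : ℝ) (hσ : 0 < σ)
    (hσ2 : σ ^ 2 = (∑' x : ℤ, (x : ℝ) ^ 2 * lam ^ (x ^ 2)) / ∑' x : ℤ, lam ^ (x ^ 2)) :
    ∀ x y : ℝ, x ≠ y → ∀ h h' : ℝ, 0 ≤ h → 0 ≤ h' → ∀ n : ℕ, 1 ≤ n →
      ⌊x * (n : ℝ)⌋ ≠ ⌊y * (n : ℝ)⌋ →
      (rescaledCurve X σ n x h y ≤ h' ↔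
        rescaledCurve X σ n x h x ≤ rescaledCurve X σ n y h' x) := by
  intro x y _ h h' _ hh' n hn hxy
  have hc : 0 < 2 * σ * Real.sqrt n := by
    have : (0 : ℝ) < n := by exact_mod_cast hn
    positivity
  have hmul : h' * (2 * σ * Real.sqrt n) = 2 * σ * h' * Real.sqrt n := by ring
  simp only [rescaledCurve]
  rw [div_le_iff₀ hc, div_le_div_iff_of_pos_right hc, Nat.cast_le, hmul,
    ← Nat.le_floor_iff (by positivity)]
  exact locTime_invLocTime_duality (hX _) (hX _) hxy _ _
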